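/- arXiv:2103.04571 — 9 statements merged into one kernel-verified Lean document; each statement's English description precedes it below -/
import Mathlib

section
/- Let n ≥ 1, let H be an n×n quaternion matrix with H * Hᴴ = (n : ℝ) • 1, let σ : ℝ, and let X be an n×n quaternion matrix with X * Xᴴ = σ • 1. Denote by h_i and r_i the i-th rows of H and X (as 1×n matrices), set c_i := h_iᴴ * h_i and C_i := h_iᴴ * r_i. Then: (i) ∑_{i=0}^{n−1} C_i * C_iᴴ = (σ * n) • 1; (ii) C_i * C_iᴴ = σ • c_i for every i; (iii) C_i * C_jᴴ = 0 whenever i ≠ j. -/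
open Quaternion Matrix

/-- The `i`-th row of a matrix, regarded as a `1 × k` matrix. -/
def row1 {α : Type*} {m k : Type*} (M : Matrix m k α) (i : m) :
    Matrix (Fin 1) k α :=
  Matrix.of fun _ j => M i j

theorem row1_mul_conjTranspose_row1 {α m k : Type*} [Fintype k] [DecidableEq m] [Ring α]
    [StarRing α] [Algebra ℝ α] {X : Matrix m k α} {σ : ℝ} (hX : X * Xᴴ = σ • 1) (i j : m) :
    row1 X i * (row1 X j)ᴴ = if i = j then σ • 1 else 0 := by
  ext a b
  have h := congrFun (congrFun hX i) j
  rw [Subsingleton.elim b a]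
  split_ifs with hij
  · subst hij
    simpa [row1, Matrix.mul_apply] using h
  · simpa [row1, Matrix.mul_apply, hij] using h

theorem sum_conjTranspose_row1_mul_row1 {α m k : Type*} [Fintype m]
    [NonUnitalNonAssocSemiring α] [Star α] (H : Matrix m k α) :
    ∑ i, (row1 H i)ᴴ * row1 H i = Hᴴ * H := by
  ext a b
  simp [row1, Matrix.mul_apply, Matrix.sum_apply]

theorem mul_eq_smul_one_comm {R A : Type*} [Field R] [Ring A] [Algebra R A]
    [IsDedekindFiniteMonoid A] {a b : A} {c : R} (hc : c ≠ 0) (h : a * b = c • 1) :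
    b * a = c • 1 := by
  have h₁ : a * (c⁻¹ • b) = 1 := by rw [mul_smul_comm, h, inv_smul_smul₀ hc]
  have h₂ : (c⁻¹ • b) * a = 1 := mul_eq_one_symm h₁
  rw [← h₂, smul_mul_assoc, smul_inv_smul₀ hc]

theorem conjTranspose_row1_mul_mul_conjTranspose {α m k l : Type*} [Fintype k] [Fintype l]
    [DecidableEq m] [Ring α] [StarRing α] [Algebra ℝ α] (H : Matrix m l α) {X : Matrix m k α}
    {σ : ℝ} (hX : X * Xᴴ = σ • 1) (i j : m) :
    ((row1 H i)ᴴ * row1 X i) * ((row1 H j)ᴴ * row1 X j)ᴴ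
      = if i = j then σ • ((row1 H i)ᴴ * row1 H j) else 0 := by
  rw [conjTranspose_mul, conjTranspose_conjTranspose, Matrix.mul_assoc,
    ← Matrix.mul_assoc (row1 X i), row1_mul_conjTranspose_row1 hX]
  split_ifs <;> simp

/-- Given an `n × n` quaternion matrix `H` with `H * Hᴴ = n • 1` and an `n × n` quaternion
matrix `X` with `X * Xᴴ = σ • 1`, the matrices `C_i = h_iᴴ * r_i` satisfy:
(i) `∑ i, C_i * C_iᴴ = (σ * n) • 1`; (ii) `C_i * C_iᴴ = σ • c_i`; (iii) `C_i * C_jᴴ = 0`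
for `i ≠ j`, where `c_i = h_iᴴ * h_i`. -/
theorem auxiliary_matrices_of_design (n : ℕ) (hn : 1 ≤ n)
    (H : Matrix (Fin n) (Fin n) ℍ[ℝ]) (σ : ℝ)
    (X : Matrix (Fin n) (Fin n) ℍ[ℝ])
    (hH : H * Hᴴ = (n : ℝ) • 1) (hX : X * Xᴴ = σ • 1) :
    (∑ i : Fin n, ((row1 H i)ᴴ * row1 X i) * ((row1 H i)ᴴ * row1 X i)ᴴ
        = (σ * n) • 1) ∧
    (∀ i : Fin n, ((row1 H i)ᴴ * row1 X i) * ((row1 H i)ᴴ * row1 X i)ᴴ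
        = σ • ((row1 H i)ᴴ * row1 H i)) ∧
    (∀ i j : Fin n, i ≠ j →
      ((row1 H i)ᴴ * row1 X i) * ((row1 H j)ᴴ * row1 X j)ᴴ = 0) := by
  have hH' : Hᴴ * H = (n : ℝ) • 1 :=
    mul_eq_smul_one_comm (Nat.cast_ne_zero.mpr (by omega)) hH
  refine ⟨?_, fun i => ?_, fun i j hij => ?_⟩
  · simp_rw [conjTranspose_row1_mul_mul_conjTranspose H hX, if_true]
    rw [← Finset.smul_sum, sum_conjTranspose_row1_mul_row1, hH', smul_smul]
  · rw [conjTranspose_row1_mul_mul_conjTranspose H hX, if_pos rfl]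
  · rw [conjTranspose_row1_mul_mul_conjTranspose H hX, if_neg hij]
end

section
/- Let n ≥ 1, let H be an n×n quaternion matrix with H * Hᴴ = (n : ℝ) • 1, let σ : ℝ, and let X be an n×n quaternion matrix with X * Xᴴ = σ • 1. With h_i, r_i the i-th rows of H and X (as 1×n matrices) and C_i := h_iᴴ * r_i, the sequence (C_0, C_1, …, C_{n−1}) is a Barker sequence: for every k with 1 ≤ k ≤ n−1, ∑_{i=0}^{n−1−k} C_{i+k} * C_iᴴ = 0. -/
open Quaternion Matrix

theorem row1_mul_row1_conjTranspose {α m k : Type*} [Fintype k] [NonUnitalSemiring α] [StarRing α]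
    (M : Matrix m k α) (i j : m) :
    row1 M i * (row1 M j)ᴴ = Matrix.of fun _ _ => (M * Mᴴ) i j := by
  ext a b
  simp [row1, Matrix.mul_apply]

/-- Given an `n × n` quaternion matrix `H` with `H * Hᴴ = n • 1` and an `n × n` quaternion
matrix `X` with `X * Xᴴ = σ • 1`, the sequence `C_i = h_iᴴ * r_i` (`0 ≤ i < n`) is a Barker
sequence: all its aperiodic autocorrelations vanish. -/
theorem barker_sequence_of_design (n : ℕ) (hn : 1 ≤ n)
    (H : Matrix (Fin n) (Fin n) ℍ[ℝ]) (σ : ℝ)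
    (X : Matrix (Fin n) (Fin n) ℍ[ℝ])
    (hH : H * Hᴴ = (n : ℝ) • 1) (hX : X * Xᴴ = σ • 1)
    (C : ℕ → Matrix (Fin n) (Fin n) ℍ[ℝ])
    (hC : ∀ i : Fin n, C i = (row1 H i)ᴴ * row1 X i) :
    ∀ k : ℕ, 1 ≤ k → k ≤ n - 1 →
      ∑ i ∈ Finset.range (n - k), C (i + k) * (C i)ᴴ = 0 := by
  intro k hk _
  refine Finset.sum_eq_zero fun i hi => ?_
  have hik : i + k < n := Nat.add_lt_of_lt_sub (Finset.mem_range.mp hi)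
  have hin : i < n := by omega
  have h1 := hC ⟨i + k, hik⟩
  have h2 := hC ⟨i, hin⟩
  have hne : (⟨i + k, hik⟩ : Fin n) ≠ ⟨i, hin⟩ := by
    simp only [ne_eq, Fin.mk.injEq]
    omega
  have h0 : row1 X ⟨i + k, hik⟩ * (row1 X ⟨i, hin⟩)ᴴ = 0 := by
    rw [row1_mul_row1_conjTranspose, hX, Matrix.smul_apply, Matrix.one_apply_ne hne, smul_zero]
    rfl
  simp only at h1 h2
  rw [h1, h2, Matrix.conjTranspose_mul, Matrix.mul_assoc, ← Matrix.mul_assoc (row1 X _), h0,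
    Matrix.zero_mul, Matrix.mul_zero]
end

section
/- Let (A_i)_{i=0}^{n−1} and (B_i)_{i=0}^{n−1} be sequences of p×p quaternion matrices forming a complementary Golay pair, i.e. N_A(k) + N_B(k) = 0 for all 1 ≤ k ≤ n−1, where N_A(k) := ∑_{i=0}^{n−1−k} A_{i+k} * A_iᴴ. Then the concatenated sequences (A_0,…,A_{n−1},B_0,…,B_{n−1}) and (A_0,…,A_{n−1},−B_0,…,−B_{n−1}) of length 2n also form a complementary Golay pair: the sum of their aperiodic autocorrelations N(k) vanishes for all 1 ≤ k ≤ 2n−1. -/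
open Quaternion Matrix

/-- If the length-`n` sequences `A`, `B` of `p × p` quaternion matrices form a complementary
Golay pair, then the length-`2n` concatenations `(A, B)` and `(A, -B)` also form a
complementary Golay pair. -/
theorem golay_pair_concat (p n : ℕ) (hn : 1 ≤ n)
    (A B : ℕ → Matrix (Fin p) (Fin p) ℍ[ℝ])
    (hGolay : ∀ k : ℕ, 1 ≤ k → k ≤ n - 1 →
      (∑ i ∈ Finset.range (n - k), A (i + k) * (A i)ᴴ) +
        (∑ i ∈ Finset.range (n - k), B (i + k) * (B i)ᴴ) = 0)
    (C C' : ℕ → Matrix (Fin p) (Fin p) ℍ[ℝ])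
    (hC : ∀ i : ℕ, i < 2 * n → C i = if i < n then A i else B (i - n))
    (hC' : ∀ i : ℕ, i < 2 * n → C' i = if i < n then A i else -(B (i - n))) :
    ∀ k : ℕ, 1 ≤ k → k ≤ 2 * n - 1 →
      (∑ i ∈ Finset.range (2 * n - k), C (i + k) * (C i)ᴴ) +
        (∑ i ∈ Finset.range (2 * n - k), C' (i + k) * (C' i)ᴴ) = 0 := by
  intro k hk1 hk2
  have cross : ∀ i, i < n → n ≤ i + k → i + k < 2 * n →
      C (i + k) * (C i)ᴴ + C' (i + k) * (C' i)ᴴ = 0 := by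
    intro i hi hik hlt
    rw [hC _ hlt, hC i (by omega), hC' _ hlt, hC' i (by omega)]
    simp [hi, not_lt.mpr hik]
  rw [← Finset.sum_add_distrib]
  rcases lt_or_ge k n with hkn | hkn
  · have left : ∀ i ∈ Finset.range (n - k), C (i + k) * (C i)ᴴ + C' (i + k) * (C' i)ᴴ =
        A (i + k) * (A i)ᴴ + A (i + k) * (A i)ᴴ := by
      intro i hi
      rw [Finset.mem_range] at hi
      rw [hC _ (by omega), hC i (by omega), hC' _ (by omega), hC' i (by omega)]
      simp [show i < n by omega, show i + k < n by omega]
    have middle : ∀ j ∈ Finset.range k, C (n - k + j + k) * (C (n - k + j))ᴴ +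
        C' (n - k + j + k) * (C' (n - k + j))ᴴ = 0 := by
      intro j hj
      rw [Finset.mem_range] at hj
      exact cross _ (by omega) (by omega) (by omega)
    have right : ∀ j ∈ Finset.range (n - k), C (n + j + k) * (C (n + j))ᴴ +
        C' (n + j + k) * (C' (n + j))ᴴ = B (j + k) * (B j)ᴴ + B (j + k) * (B j)ᴴ := by
      intro j hj
      rw [Finset.mem_range] at hj
      rw [hC _ (by omega), hC (n + j) (by omega), hC' _ (by omega), hC' (n + j) (by omega)]
      simp [show ¬ n + j + k < n by omega, show n + j + k - n = j + k by omega]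
    rw [show 2 * n - k = n - k + k + (n - k) by omega, Finset.sum_range_add,
      Finset.sum_range_add, Finset.sum_congr rfl left, Finset.sum_eq_zero middle,
      Nat.sub_add_cancel hkn.le, Finset.sum_congr rfl right, add_zero,
      Finset.sum_add_distrib, Finset.sum_add_distrib, add_add_add_comm,
      hGolay k hk1 (by omega), add_zero]
  · refine Finset.sum_eq_zero fun i hi => ?_
    rw [Finset.mem_range] at hi
    exact cross i (by omega) (by omega) (by omega)
end

section
/- Fix q ≥ 1 and a real q×q matrix Q with Qᵗ = −Q, Q * Qᵗ = (q:ℝ) • 1 − J_q, and Q * J_q = J_q * Q = 0 (J_q the all-ones matrix). For real numbers a, b define recursively the q^m × q^m real matrices 𝒥_0 = (a), 𝒜_0 = (b), 𝒥_{m+1} = J_q ⊗ 𝒜_m, 𝒜_{m+1} = I_q ⊗ 𝒥_m + Q ⊗ 𝒜_m. Then for every m ≥ 0, 𝒥_m * 𝒜_mᵗ = 𝒜_m * 𝒥_mᵗ. -/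
open Matrix Kronecker

/-- Index type for the recursively defined matrices of order `q^m`. -/
def idx (q : ℕ) : ℕ → Type
  | 0 => Fin 1
  | m + 1 => Fin q × idx q m

instance idxFintype (q : ℕ) : (m : ℕ) → Fintype (idx q m)
  | 0 => inferInstanceAs (Fintype (Fin 1))
  | m + 1 => haveI := idxFintype q m; inferInstanceAs (Fintype (Fin q × idx q m))

instance idxDecEq (q : ℕ) : (m : ℕ) → DecidableEq (idx q m)
  | 0 => inferInstanceAs (DecidableEq (Fin 1))
  | m + 1 => haveI := idxDecEq q m; inferInstanceAs (DecidableEq (Fin q × idx q m))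

/-- The all-ones matrix `J_q`. -/
def Jq (q : ℕ) : Matrix (Fin q) (Fin q) ℝ := Matrix.of fun _ _ => 1

/-- The pair `(𝒥_m, 𝒜_m)` defined recursively by `𝒥_0 = (a)`, `𝒜_0 = (b)`,
`𝒥_{m+1} = J_q ⊗ 𝒜_m`, `𝒜_{m+1} = I_q ⊗ 𝒥_m + Q ⊗ 𝒜_m`. -/
def JA (q : ℕ) (Q : Matrix (Fin q) (Fin q) ℝ) (a b : ℝ) :
    (m : ℕ) → Matrix (idx q m) (idx q m) ℝ × Matrix (idx q m) (idx q m) ℝ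
  | 0 => (Matrix.of fun _ _ => a, Matrix.of fun _ _ => b)
  | m + 1 =>
      (Jq q ⊗ₖ (JA q Q a b m).2,
       (1 : Matrix (Fin q) (Fin q) ℝ) ⊗ₖ (JA q Q a b m).1 + Q ⊗ₖ (JA q Q a b m).2)

theorem kronecker_mul_transpose_amicable {ι κ : Type*} [Fintype ι] [DecidableEq ι] [Fintype κ]
    {S Q : Matrix ι ι ℝ} (hS : Sᵀ = S) (hQS : Q * S = 0) {J A : Matrix κ κ ℝ}
    (hJA : J * Aᵀ = A * Jᵀ) :
    (S ⊗ₖ A) * ((1 : Matrix ι ι ℝ) ⊗ₖ J + Q ⊗ₖ A)ᵀ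
      = ((1 : Matrix ι ι ℝ) ⊗ₖ J + Q ⊗ₖ A) * (S ⊗ₖ A)ᵀ := by
  have hSQ : S * Qᵀ = 0 := by
    simpa [hS] using congrArg transpose hQS
  rw [transpose_add, ← kroneckerMap_transpose, ← kroneckerMap_transpose, ← kroneckerMap_transpose,
    mul_add, add_mul, ← mul_kronecker_mul, ← mul_kronecker_mul, ← mul_kronecker_mul,
    ← mul_kronecker_mul, hS, hQS, hSQ, transpose_one, mul_one, one_mul, hJA,
    zero_kronecker]

/-- `𝒥_m * 𝒜_mᵗ = 𝒜_m * 𝒥_mᵗ` for the matrices built from the core `Q` of a skew-symmetric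
conference matrix. -/
theorem JA_amicable (q : ℕ) (hq : 1 ≤ q) (Q : Matrix (Fin q) (Fin q) ℝ)
    (hQskew : Qᵀ = -Q)
    (hQQ : Q * Qᵀ = (q : ℝ) • 1 - Jq q)
    (hQJ : Q * Jq q = 0) (hJQ : Jq q * Q = 0)
    (a b : ℝ) :
    ∀ m : ℕ, (JA q Q a b m).1 * ((JA q Q a b m).2)ᵀ
      = (JA q Q a b m).2 * ((JA q Q a b m).1)ᵀ := by
  intro m
  induction m with
  | zero =>
    ext i j
    simp only [JA, mul_apply, transpose_apply, of_apply, mul_comm]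
  | succ m ih => exact kronecker_mul_transpose_amicable rfl hQJ ih
end

section
/- Fix q ≥ 1 and a real q×q matrix Q with Qᵗ = −Q, Q * Qᵗ = (q:ℝ) • 1 − J_q, and Q * J_q = J_q * Q = 0. For real numbers a, b define recursively 𝒥_0 = (a), 𝒜_0 = (b), 𝒥_{m+1} = J_q ⊗ 𝒜_m, 𝒜_{m+1} = I_q ⊗ 𝒥_m + Q ⊗ 𝒜_m. Then for every m ≥ 0, 𝒥_m * 𝒥_mᵗ + (q:ℝ) • (𝒜_m * 𝒜_mᵗ) = (q^m * a^2 + q^{m+1} * b^2) • 1 (identity matrix of order q^m). -/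
open Matrix Kronecker

section KroneckerStep

variable {m n : Type*} [Fintype m] [DecidableEq m] [Fintype n]

theorem kronecker_mul_transpose_symm {E Q : Matrix m m ℝ} {X Y : Matrix n n ℝ}
    (hE : Eᵀ = E) (hQ : Qᵀ = -Q) (hEQ : E * Q = 0) (hQE : Q * E = 0)
    (hXY : X * Yᵀ = Y * Xᵀ) :
    (E ⊗ₖ Y) * ((1 : Matrix m m ℝ) ⊗ₖ X + Q ⊗ₖ Y)ᵀ
      = ((1 : Matrix m m ℝ) ⊗ₖ X + Q ⊗ₖ Y) * (E ⊗ₖ Y)ᵀ := by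
  have h : E * Qᵀ = 0 := by rw [hQ, mul_neg, hEQ, neg_zero]
  simp only [transpose_add, ← kroneckerMap_transpose, transpose_one, mul_add, add_mul,
    ← mul_kronecker_mul, mul_one, one_mul, hE, h, hQE, hXY, zero_kronecker]

theorem kronecker_mul_transpose_add {E Q : Matrix m m ℝ} {X Y : Matrix n n ℝ} {c : ℝ}
    (hEE : E * Eᵀ = c • E) (hQ : Qᵀ = -Q) (hQQ : Q * Qᵀ = c • 1 - E)
    (hXY : X * Yᵀ = Y * Xᵀ) :
    (E ⊗ₖ Y) * (E ⊗ₖ Y)ᵀ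
        + c • (((1 : Matrix m m ℝ) ⊗ₖ X + Q ⊗ₖ Y) * ((1 : Matrix m m ℝ) ⊗ₖ X + Q ⊗ₖ Y)ᵀ)
      = c • ((1 : Matrix m m ℝ) ⊗ₖ (X * Xᵀ + c • (Y * Yᵀ))) := by
  simp only [transpose_add, ← kroneckerMap_transpose, transpose_one, mul_add, add_mul,
    ← mul_kronecker_mul, mul_one, one_mul, hEE, hQQ, hXY]
  rw [hQ]
  ext ⟨i, j⟩ ⟨k, l⟩
  simp only [Matrix.add_apply, Matrix.smul_apply, kroneckerMap_apply, Matrix.sub_apply,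
    Matrix.neg_apply, smul_eq_mul]
  ring

end KroneckerStep

theorem Jq_transpose (q : ℕ) : (Jq q)ᵀ = Jq q := rfl

theorem Jq_mul_transpose (q : ℕ) : Jq q * (Jq q)ᵀ = (q : ℝ) • Jq q := by
  ext i j
  simp [Jq, mul_apply]

theorem JA_mul_transpose_symm {q : ℕ} {Q : Matrix (Fin q) (Fin q) ℝ} (hQskew : Qᵀ = -Q)
    (hQJ : Q * Jq q = 0) (hJQ : Jq q * Q = 0) (a b : ℝ) :
    ∀ m : ℕ, (JA q Q a b m).1 * ((JA q Q a b m).2)ᵀ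
      = (JA q Q a b m).2 * ((JA q Q a b m).1)ᵀ
  | 0 => by
    ext i j
    simp [JA, mul_apply, mul_comm]
  | m + 1 => kronecker_mul_transpose_symm (Jq_transpose q) hQskew hJQ hQJ
      (JA_mul_transpose_symm hQskew hQJ hJQ a b m)

theorem one_kronecker_one_idx (q m : ℕ) :
    (1 : Matrix (Fin q) (Fin q) ℝ) ⊗ₖ (1 : Matrix (idx q m) (idx q m) ℝ)
      = (1 : Matrix (idx q (m + 1)) (idx q (m + 1)) ℝ) :=
  one_kronecker_one

/-- `𝒥_m * 𝒥_mᵗ + q • (𝒜_m * 𝒜_mᵗ) = (q^m a² + q^{m+1} b²) • 1` for the matrices built from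
the core `Q` of a skew-symmetric conference matrix. -/
theorem JA_orthogonality (q : ℕ) (hq : 1 ≤ q) (Q : Matrix (Fin q) (Fin q) ℝ)
    (hQskew : Qᵀ = -Q)
    (hQQ : Q * Qᵀ = (q : ℝ) • 1 - Jq q)
    (hQJ : Q * Jq q = 0) (hJQ : Jq q * Q = 0)
    (a b : ℝ) :
    ∀ m : ℕ, (JA q Q a b m).1 * ((JA q Q a b m).1)ᵀ
        + (q : ℝ) • ((JA q Q a b m).2 * ((JA q Q a b m).2)ᵀ)
      = ((q : ℝ) ^ m * a ^ 2 + (q : ℝ) ^ (m + 1) * b ^ 2) • 1 := by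
  intro m
  induction m with
  | zero =>
    ext i j
    have hij : i = j := Subsingleton.elim (α := Fin 1) i j
    have hcard : Fintype.card (idx q 0) = 1 := Fintype.card_fin 1
    subst hij
    simp [JA, mul_apply, hcard]
    ring
  | succ m ih =>
    refine (kronecker_mul_transpose_add (Jq_mul_transpose q) hQskew hQQ
      (JA_mul_transpose_symm hQskew hQJ hJQ a b m)).trans ?_
    rw [ih, kronecker_smul, smul_smul, one_kronecker_one_idx]
    congr 1
    ring
end

section
/- Fix q ≥ 1, a real q×q matrix Q with Qᵗ = −Q, Q * Qᵗ = (q:ℝ) • 1 − J_q, Q * J_q = J_q * Q = 0, and a real (q+1)×(q+1) matrix S with Sᵗ = −S and S * Sᵗ = (q:ℝ) • 1. For real a, b define 𝒥_m, 𝒜_m recursively by 𝒥_0 = (a), 𝒜_0 = (b), 𝒥_{m+1} = J_q ⊗ 𝒜_m, 𝒜_{m+1} = I_q ⊗ 𝒥_m + Q ⊗ 𝒜_m, and set X_m := I_{q+1} ⊗ 𝒥_m + S ⊗ 𝒜_m, a square real matrix of order q^m (q+1). Then X_m * X_mᵗ = (q^m * a^2 + q^{m+1} * b^2) • 1. (Thus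 X_m is an orthogonal design OD(q^m(q+1); q^m, q^{m+1}) in the variables a, b.) -/
open Matrix Kronecker

/-- If `A * Bᵀ` is symmetric and `M` is skew-symmetric, the cross terms cancel in the Gram matrix of
`1 ⊗ A + M ⊗ B`. -/
theorem one_kronecker_add_mul_transpose {R n k : Type*} [CommRing R] [Fintype n] [DecidableEq n]
    [Fintype k] {M : Matrix n n R} {A B : Matrix k k R} (hM : Mᵀ = -M) (hAB : A * Bᵀ = B * Aᵀ) :
    ((1 : Matrix n n R) ⊗ₖ A + M ⊗ₖ B) * ((1 : Matrix n n R) ⊗ₖ A + M ⊗ₖ B)ᵀ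
      = (1 : Matrix n n R) ⊗ₖ (A * Aᵀ) + (M * Mᵀ) ⊗ₖ (B * Bᵀ) := by
  have h : M ⊗ₖ (B * Aᵀ) + Mᵀ ⊗ₖ (B * Aᵀ) = 0 := by
    rw [← add_kronecker, hM, add_neg_cancel, zero_kronecker]
  rw [transpose_add, ← kroneckerMap_transpose, ← kroneckerMap_transpose, add_mul, mul_add, mul_add]
  simp only [← mul_kronecker_mul, transpose_one, one_mul, mul_one]
  rw [hAB, ← sub_eq_zero, ← h]
  abel

theorem Jq_mul_Jq (q : ℕ) : Jq q * Jq q = (q : ℝ) • Jq q := by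
  ext i j
  simp [Jq, mul_apply]

/-- If `A * Bᵀ` is symmetric and `A * Aᵀ + q B * Bᵀ` is scalar, then the same holds for the pair
`J_q ⊗ B`, `1 ⊗ A + Q ⊗ B`. -/
theorem Jq_kronecker_mul_transpose {q : ℕ} {Q : Matrix (Fin q) (Fin q) ℝ} (hQskew : Qᵀ = -Q)
    (hQQ : Q * Qᵀ = (q : ℝ) • 1 - Jq q) (hQJ : Q * Jq q = 0) (hJQ : Jq q * Q = 0)
    {k : Type*} [Fintype k] [DecidableEq k] {A B : Matrix k k ℝ} {c : ℝ}
    (hsymm : A * Bᵀ = B * Aᵀ) (hscalar : A * Aᵀ + (q : ℝ) • (B * Bᵀ) = c • 1) :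
    (Jq q ⊗ₖ B) * ((1 : Matrix (Fin q) (Fin q) ℝ) ⊗ₖ A + Q ⊗ₖ B)ᵀ
        = ((1 : Matrix (Fin q) (Fin q) ℝ) ⊗ₖ A + Q ⊗ₖ B) * (Jq q ⊗ₖ B)ᵀ ∧
      (Jq q ⊗ₖ B) * (Jq q ⊗ₖ B)ᵀ + (q : ℝ) • (((1 : Matrix (Fin q) (Fin q) ℝ) ⊗ₖ A + Q ⊗ₖ B)
        * ((1 : Matrix (Fin q) (Fin q) ℝ) ⊗ₖ A + Q ⊗ₖ B)ᵀ) = ((q : ℝ) * c) • 1 := by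
  constructor
  · rw [transpose_add, ← kroneckerMap_transpose, ← kroneckerMap_transpose,
      ← kroneckerMap_transpose, mul_add, add_mul]
    simp only [← mul_kronecker_mul, transpose_one, one_mul, mul_one, Jq_transpose, hQskew,
      mul_neg, hJQ, hQJ, neg_zero, zero_kronecker, add_zero, hsymm]
  · rw [one_kronecker_add_mul_transpose hQskew hsymm, hQQ, ← kroneckerMap_transpose,
      ← mul_kronecker_mul, Jq_transpose, Jq_mul_Jq, mul_smul, ← one_kronecker_one,
      ← kronecker_smul, ← hscalar, sub_eq_add_neg, add_kronecker, kronecker_add, smul_kronecker,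
      smul_kronecker, kronecker_smul, ← neg_one_smul ℝ (Jq q), smul_kronecker]
    module

/-- `𝒥_m * 𝒜_mᵀ` is symmetric, and `𝒥_m * 𝒥_mᵀ + q 𝒜_m * 𝒜_mᵀ` is scalar. -/
theorem JA_mul_transpose {q : ℕ} {Q : Matrix (Fin q) (Fin q) ℝ} (hQskew : Qᵀ = -Q)
    (hQQ : Q * Qᵀ = (q : ℝ) • 1 - Jq q) (hQJ : Q * Jq q = 0) (hJQ : Jq q * Q = 0) (a b : ℝ)
    (m : ℕ) :
    (JA q Q a b m).1 * (JA q Q a b m).2ᵀ = (JA q Q a b m).2 * (JA q Q a b m).1ᵀ ∧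
      (JA q Q a b m).1 * (JA q Q a b m).1ᵀ + (q : ℝ) • ((JA q Q a b m).2 * (JA q Q a b m).2ᵀ)
        = ((q : ℝ) ^ m * a ^ 2 + (q : ℝ) ^ (m + 1) * b ^ 2) • 1 := by
  induction m with
  | zero =>
    have h (x y : ℝ) : (of fun _ _ => x : Matrix (Fin 1) (Fin 1) ℝ) *
        (of fun _ _ => y : Matrix (Fin 1) (Fin 1) ℝ)ᵀ = (x * y) • 1 := by
      ext i j
      simp [mul_apply, one_apply, Subsingleton.elim i j]
    have hJA : (of fun _ _ => a) * (of fun _ _ => b)ᵀ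
          = (of fun _ _ => b) * (of fun _ _ => a : Matrix (Fin 1) (Fin 1) ℝ)ᵀ ∧
        (of fun _ _ => a) * (of fun _ _ => a)ᵀ
          + (q : ℝ) • ((of fun _ _ => b) * (of fun _ _ => b : Matrix (Fin 1) (Fin 1) ℝ)ᵀ)
          = ((q : ℝ) ^ 0 * a ^ 2 + (q : ℝ) ^ (0 + 1) * b ^ 2) • 1 := by
      simp only [h]
      exact ⟨by rw [mul_comm], by module⟩
    exact hJA
  | succ m ih =>
    have hc : (q : ℝ) ^ (m + 1) * a ^ 2 + (q : ℝ) ^ (m + 1 + 1) * b ^ 2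
        = q * ((q : ℝ) ^ m * a ^ 2 + (q : ℝ) ^ (m + 1) * b ^ 2) := by ring
    rw [hc]
    exact Jq_kronecker_mul_transpose hQskew hQQ hQJ hJQ ih.1 ih.2

/-- `X_m = I_{q+1} ⊗ 𝒥_m + S ⊗ 𝒜_m` is an orthogonal design `OD(q^m(q+1); q^m, q^{m+1})`:
`X_m * X_mᵗ = (q^m a² + q^{m+1} b²) • 1`. -/
theorem Xm_orthogonal_design (q : ℕ) (hq : 1 ≤ q) (Q : Matrix (Fin q) (Fin q) ℝ)
    (hQskew : Qᵀ = -Q)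
    (hQQ : Q * Qᵀ = (q : ℝ) • 1 - Jq q)
    (hQJ : Q * Jq q = 0) (hJQ : Jq q * Q = 0)
    (S : Matrix (Fin (q + 1)) (Fin (q + 1)) ℝ)
    (hSskew : Sᵀ = -S) (hSS : S * Sᵀ = (q : ℝ) • 1)
    (a b : ℝ) :
    ∀ m : ℕ,
      ((1 : Matrix (Fin (q + 1)) (Fin (q + 1)) ℝ) ⊗ₖ (JA q Q a b m).1 + S ⊗ₖ (JA q Q a b m).2)
        * ((1 : Matrix (Fin (q + 1)) (Fin (q + 1)) ℝ) ⊗ₖ (JA q Q a b m).1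
            + S ⊗ₖ (JA q Q a b m).2)ᵀ
      = ((q : ℝ) ^ m * a ^ 2 + (q : ℝ) ^ (m + 1) * b ^ 2) • 1 := by
  intro m
  obtain ⟨hsymm, hscalar⟩ := JA_mul_transpose hQskew hQQ hQJ hJQ a b m
  rw [one_kronecker_add_mul_transpose hSskew hsymm, hSS, smul_kronecker, ← kronecker_smul,
    ← kronecker_add, hscalar, kronecker_smul, one_kronecker_one]
end

section
/- Fix q ≥ 1 and a real q×q matrix Q with Qᵗ = Q, Q * Qᵗ = (q:ℝ) • 1 − J_q, and Q * J_q = J_q * Q = 0. For real numbers a, b define recursively the q^m × q^m complex matrices 𝒞_0 = (a), 𝒟_0 = (b), 𝒞_{m+1} = J_q ⊗ 𝒟_m, 𝒟_{m+1} = I_q ⊗ 𝒞_m + (Complex.I • Q) ⊗ 𝒟_m. Then for every m ≥ 0: (i) 𝒞_m * 𝒟_mᴴ = 𝒟_m * 𝒞_mᴴ, and (ii) 𝒞_m * 𝒞_mᴴ + (q:ℝ) • (𝒟_m * 𝒟_mᴴ) = (q^m * a^2 + q^{m+1} * b^2) • 1. -/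
open Matrix Kronecker

/-- The complex all-ones matrix `J_q`. -/
def JqC (q : ℕ) : Matrix (Fin q) (Fin q) ℂ := Matrix.of fun _ _ => 1

/-- The pair `(𝒞_m, 𝒟_m)` of complex matrices defined recursively by `𝒞_0 = (a)`,
`𝒟_0 = (b)`, `𝒞_{m+1} = J_q ⊗ 𝒟_m`, `𝒟_{m+1} = I_q ⊗ 𝒞_m + (i Q) ⊗ 𝒟_m`. -/
def CD (q : ℕ) (Q : Matrix (Fin q) (Fin q) ℝ) (a b : ℝ) :
    (m : ℕ) → Matrix (idx q m) (idx q m) ℂ × Matrix (idx q m) (idx q m) ℂ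
  | 0 => (Matrix.of fun _ _ => (a : ℂ), Matrix.of fun _ _ => (b : ℂ))
  | m + 1 =>
      (JqC q ⊗ₖ (CD q Q a b m).2,
       (1 : Matrix (Fin q) (Fin q) ℂ) ⊗ₖ (CD q Q a b m).1
         + (Complex.I • Q.map (Complex.ofReal)) ⊗ₖ (CD q Q a b m).2)

theorem JqC_conjTranspose (q : ℕ) : (JqC q)ᴴ = JqC q := by
  ext i j
  simp [JqC]

theorem JqC_mul_self (q : ℕ) : JqC q * JqC q = (q : ℂ) • JqC q := by
  ext i j
  simp [JqC, Matrix.mul_apply]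

/-- The first identity is preserved by `(C, D) ↦ (J ⊗ D, 1 ⊗ C + P ⊗ D)`. -/
theorem kronecker_step_mul_conjTranspose_comm {l n : Type*} [Fintype l] [DecidableEq l]
    [Fintype n] {J P : Matrix l l ℂ} (hJ : Jᴴ = J) (hP : Pᴴ = -P)
    (hPJ : P * J = 0) (hJP : J * P = 0) {C D : Matrix n n ℂ} (h : C * Dᴴ = D * Cᴴ) :
    (J ⊗ₖ D) * (1 ⊗ₖ C + P ⊗ₖ D)ᴴ = (1 ⊗ₖ C + P ⊗ₖ D) * (J ⊗ₖ D)ᴴ := by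
  simp only [conjTranspose_add, conjTranspose_kronecker, conjTranspose_one, hJ, hP, mul_add,
    add_mul, ← mul_kronecker_mul, mul_one, one_mul, mul_neg, hPJ, hJP, neg_zero,
    zero_kronecker, add_zero, h]

/-- The map `(C, D) ↦ (J ⊗ D, 1 ⊗ C + P ⊗ D)` sends `N = C Cᴴ + c D Dᴴ` to `c (1 ⊗ N)`. -/
theorem kronecker_step_norm_form {l n : Type*} [Fintype l] [DecidableEq l]
    [Fintype n] {J P : Matrix l l ℂ} {c : ℂ} (hJ : Jᴴ = J) (hJJ : J * J = c • J)
    (hP : Pᴴ = -P) (hPP : P * P = J - c • 1)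
    {C D : Matrix n n ℂ} (h : C * Dᴴ = D * Cᴴ) :
    (J ⊗ₖ D) * (J ⊗ₖ D)ᴴ + c • ((1 ⊗ₖ C + P ⊗ₖ D) * (1 ⊗ₖ C + P ⊗ₖ D)ᴴ) =
      c • (1 ⊗ₖ (C * Cᴴ + c • (D * Dᴴ))) := by
  simp only [conjTranspose_add, conjTranspose_kronecker, conjTranspose_one, hJ, hP, mul_add,
    add_mul, ← mul_kronecker_mul, mul_one, one_mul, mul_neg, hJJ, hPP, h]
  ext ⟨i, i'⟩ ⟨j, j'⟩
  simp only [Matrix.add_apply, Matrix.smul_apply, kroneckerMap_apply, Matrix.neg_apply,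
    Matrix.sub_apply, smul_eq_mul]
  ring

/-- For the matrices `𝒞_m`, `𝒟_m` built from the symmetric core `Q` of a symmetric
conference matrix: (i) `𝒞_m * 𝒟_mᴴ = 𝒟_m * 𝒞_mᴴ` and
(ii) `𝒞_m * 𝒞_mᴴ + q • (𝒟_m * 𝒟_mᴴ) = (q^m a² + q^{m+1} b²) • 1`. -/
theorem CD_properties (q : ℕ) (hq : 1 ≤ q) (Q : Matrix (Fin q) (Fin q) ℝ)
    (hQsymm : Qᵀ = Q)
    (hQQ : Q * Qᵀ = (q : ℝ) • 1 - Matrix.of fun _ _ => (1 : ℝ))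
    (hQJ : Q * (Matrix.of fun _ _ => (1 : ℝ)) = 0)
    (hJQ : (Matrix.of fun _ _ => (1 : ℝ)) * Q = 0)
    (a b : ℝ) :
    ∀ m : ℕ,
      (CD q Q a b m).1 * ((CD q Q a b m).2)ᴴ = (CD q Q a b m).2 * ((CD q Q a b m).1)ᴴ ∧
      (CD q Q a b m).1 * ((CD q Q a b m).1)ᴴ + (q : ℝ) • ((CD q Q a b m).2 * ((CD q Q a b m).2)ᴴ)
        = ((q : ℝ) ^ m * a ^ 2 + (q : ℝ) ^ (m + 1) * b ^ 2) • 1 := by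
  have hP : (Complex.I • Q.map Complex.ofReal)ᴴ = -(Complex.I • Q.map Complex.ofReal) := by
    ext i j
    have := congrFun (congrFun hQsymm i) j
    simp only [transpose_apply] at this
    simp [this]
  have hPJ : (Complex.I • Q.map Complex.ofReal) * JqC q = 0 := by
    ext i j
    have := congrArg Complex.ofReal (congrFun (congrFun hQJ i) j)
    simp only [mul_apply, of_apply, mul_one, Matrix.zero_apply, Complex.ofReal_sum,
      Complex.ofReal_zero] at this
    simp [JqC, mul_apply, ← Finset.mul_sum, this]
  have hJP : JqC q * (Complex.I • Q.map Complex.ofReal) = 0 := by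
    ext i j
    have := congrArg Complex.ofReal (congrFun (congrFun hJQ i) j)
    simp only [mul_apply, of_apply, one_mul, Matrix.zero_apply, Complex.ofReal_sum,
      Complex.ofReal_zero] at this
    simp [JqC, mul_apply, ← Finset.mul_sum, this]
  have hPP : (Complex.I • Q.map Complex.ofReal) * (Complex.I • Q.map Complex.ofReal) =
      JqC q - (q : ℂ) • 1 := by
    have hmap : Q.map Complex.ofReal * Q.map Complex.ofReal = (q : ℂ) • 1 - JqC q := by
      rw [hQsymm] at hQQ
      ext i j
      have := congrArg Complex.ofReal (congrFun (congrFun hQQ i) j)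
      simp only [mul_apply, Complex.ofReal_sum, Complex.ofReal_mul] at this
      simp only [mul_apply, map_apply, this]
      by_cases hij : i = j <;> simp [JqC, one_apply, hij]
    rw [smul_mul_smul_comm, Complex.I_mul_I, hmap, neg_one_smul, neg_sub]
  intro m
  induction m with
  | zero =>
    constructor
    · ext i j
      simp [CD, mul_apply, mul_comm]
    · ext i j
      have hij : i = j := Subsingleton.elim (α := Fin 1) i j
      have hcard : Fintype.card (idx q 0) = 1 := Fintype.card_fin 1
      simp [CD, mul_apply, hij, hcard]
      ring
  | succ m ih =>
    obtain ⟨ih₁, ih₂⟩ := ih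
    refine ⟨kronecker_step_mul_conjTranspose_comm (JqC_conjTranspose q) hP hPJ hJP ih₁, ?_⟩
    have key := kronecker_step_norm_form (JqC_conjTranspose q) (JqC_mul_self q) hP hPP ih₁
    have hsmul : ∀ {k : Type} (M : Matrix k k ℂ), (q : ℂ) • M = (q : ℝ) • M := by
      intro k M
      ext i j
      simp
    rw [hsmul, hsmul (_ * _), ih₂, kronecker_smul, one_kronecker_one, hsmul, smul_smul] at key
    refine key.trans ?_
    congr 1
    ring
end

section
/- Fix q ≥ 1, a real symmetric q×q matrix Q with Qᵗ = Q, Q * Qᵗ = (q:ℝ) • 1 − J_q, Q * J_q = J_q * Q = 0, and a real (q+1)×(q+1) matrix S with Sᵗ = S, S * Sᵗ = (q:ℝ) • 1, zero diagonal, and off-diagonal entries in {1, −1}. For real a, b set 𝒞_1 = b • J_q, 𝒟_1 = a • I_q + (Complex.I * b) • Q (complex matrices), and let Y' be the q × q(q+1) complex matrix whose block columns, indexed by j ∈ Fin(q+1), are B_0 = Complex.I • 𝒞_1 and B_j = S_{0j} • 𝒟_1 for j ≥ 1 (the first q rows of Y_1 = Complex.I • (I_{q+1} ⊗ 𝒞_1)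 + S ⊗ 𝒟_1). Then the (i,j) block (of size q×q) of (Y')ᴴ * Y' equals: (q b²) • J_q if i = j = 0; (−Complex.I * S_{0j} * a * b) • J_q if i = 0 < j; (Complex.I * S_{0i} * a * b) • J_q if j = 0 < i; and (S_{0i} S_{0j}) • (a² • I_q + b² • ((q:ℝ) • I_q − J_q)) if i, j ≥ 1. (Hence Y_1 is an unfaithful balancedly splittable complex orthogonal design.) -/
open Matrix

/-- The submatrix `Y'` formed by the first `q` rows of
`Y_1 = i • (I_{q+1} ⊗ 𝒞_1) + S ⊗ 𝒟_1` (block columns `B_0 = i • 𝒞_1`, `𝒞_1 = b • J_q`,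
and `B_j = S 0 j • 𝒟_1`, `𝒟_1 = a • I_q + (i b) • Q`) satisfies: the `(i,j)` block of
`Y'ᴴ * Y'` is `(q b²) • J_q` for `i = j = 0`, `(-i S 0 j a b) • J_q` for `i = 0 < j`,
`(i S 0 i a b) • J_q` for `j = 0 < i`, and
`(S 0 i S 0 j) • (a² • I_q + b² • (q • I_q - J_q))` for `i, j ≥ 1`.  Hence `Y_1` is an
unfaithful balancedly splittable complex orthogonal design. -/
theorem Y1_unfaithful_balancedly_splittable (q : ℕ) (hq : 1 ≤ q)
    (Q : Matrix (Fin q) (Fin q) ℝ)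
    (hQsymm : Qᵀ = Q)
    (hQQ : Q * Qᵀ = (q : ℝ) • 1 - Matrix.of fun _ _ => (1 : ℝ))
    (hQJ : Q * (Matrix.of fun _ _ => (1 : ℝ)) = 0)
    (hJQ : (Matrix.of fun _ _ => (1 : ℝ)) * Q = 0)
    (S : Matrix (Fin (q + 1)) (Fin (q + 1)) ℝ)
    (hSsymm : Sᵀ = S) (hSS : S * Sᵀ = (q : ℝ) • 1)
    (hSdiag : ∀ i, S i i = 0)
    (hSoff : ∀ i j, i ≠ j → S i j = 1 ∨ S i j = -1)
    (a b : ℝ)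
    (Y' : Matrix (Fin q) (Fin (q + 1) × Fin q) ℂ)
    (hY' : ∀ (i : Fin q) (j : Fin (q + 1)) (l : Fin q),
      Y' i (j, l) = if j = 0 then Complex.I * (((b : ℂ) • JqC q) i l)
        else (S 0 j : ℂ) * (((a : ℂ) • (1 : Matrix (Fin q) (Fin q) ℂ)
          + (Complex.I * (b : ℂ)) • Q.map (Complex.ofReal)) i l)) :
    (∀ k l : Fin q, (Y'ᴴ * Y') (0, k) (0, l) = (((q : ℝ) * b ^ 2 : ℝ) : ℂ) * JqC q k l) ∧
    (∀ j : Fin (q + 1), j ≠ 0 → ∀ k l : Fin q,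
      (Y'ᴴ * Y') (0, k) (j, l) = -Complex.I * (S 0 j : ℂ) * (a : ℂ) * (b : ℂ) * JqC q k l) ∧
    (∀ i : Fin (q + 1), i ≠ 0 → ∀ k l : Fin q,
      (Y'ᴴ * Y') (i, k) (0, l) = Complex.I * (S 0 i : ℂ) * (a : ℂ) * (b : ℂ) * JqC q k l) ∧
    (∀ i j : Fin (q + 1), i ≠ 0 → j ≠ 0 → ∀ k l : Fin q,
      (Y'ᴴ * Y') (i, k) (j, l)
        = ((S 0 i : ℂ) * (S 0 j : ℂ)) * (((a : ℂ) ^ 2 • (1 : Matrix (Fin q) (Fin q) ℂ)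
            + (b : ℂ) ^ 2 • (((q : ℝ) : ℂ) • (1 : Matrix (Fin q) (Fin q) ℂ) - JqC q)) k l)) := by
  have hcol : ∀ l, ∑ m, (Q m l : ℂ) = 0 := fun l => by
    have h := congrFun (congrFun hJQ l) l
    simp only [Matrix.mul_apply, Matrix.of_apply, one_mul, Matrix.zero_apply] at h
    exact_mod_cast h
  have hsymm : ∀ m l, Q m l = Q l m := fun m l => congrFun (congrFun hQsymm l) m
  have hgram : ∀ k l, ∑ m, (Q m k : ℂ) * (Q m l : ℂ)
      = (q : ℂ) * (1 : Matrix (Fin q) (Fin q) ℂ) k l - 1 := fun k l => by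
    have h := congrFun (congrFun hQQ k) l
    simp only [Matrix.mul_apply, Matrix.transpose_apply, Matrix.sub_apply, Matrix.smul_apply,
      Matrix.of_apply, smul_eq_mul, hsymm k, hsymm l] at h
    have h' := congrArg Complex.ofReal h
    push_cast at h'
    rw [h']
    by_cases hkl : k = l <;> simp [Matrix.one_apply, hkl]
  have hone : ∀ l, ∑ m, (1 : Matrix (Fin q) (Fin q) ℂ) m l = 1 := fun l => by
    simp [Matrix.one_apply]
  have hstar : ∀ m k, star ((1 : Matrix (Fin q) (Fin q) ℂ) m k)
      = (1 : Matrix (Fin q) (Fin q) ℂ) m k := fun m k => by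
    by_cases h : m = k <;> simp [Matrix.one_apply, h]
  have hzero : ∀ m l, Y' m (0, l) = Complex.I * b := fun m l => by
    simp [hY', JqC]
  have hpos : ∀ j, j ≠ 0 → ∀ m l, Y' m (j, l) = (S 0 j : ℂ) *
      (a * (1 : Matrix (Fin q) (Fin q) ℂ) m l + Complex.I * b * (Q m l : ℂ)) :=
    fun j hj m l => by
      rw [hY', if_neg hj]
      simp only [Matrix.add_apply, Matrix.smul_apply, Matrix.map_apply, smul_eq_mul]
  have hreal : ∀ x : ℝ, star (x : ℂ) = x := Complex.conj_ofReal
  have hI : star Complex.I = -Complex.I := Complex.conj_I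
  have hcolsum : ∀ l, ∑ m, (a * (1 : Matrix (Fin q) (Fin q) ℂ) m l
      + Complex.I * b * (Q m l : ℂ)) = a := fun l => by
    rw [Finset.sum_add_distrib, ← Finset.mul_sum, ← Finset.mul_sum, hone, hcol]
    ring
  have hcolsum' : ∀ l, ∑ m, (a * (1 : Matrix (Fin q) (Fin q) ℂ) m l
      - Complex.I * b * (Q m l : ℂ)) = a := fun l => by
    rw [Finset.sum_sub_distrib, ← Finset.mul_sum, ← Finset.mul_sum, hone, hcol]
    ring
  have hstarpos : ∀ j, j ≠ 0 → ∀ m l, star (Y' m (j, l)) = (S 0 j : ℂ) *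
      (a * (1 : Matrix (Fin q) (Fin q) ℂ) m l - Complex.I * b * (Q m l : ℂ)) :=
    fun j hj m l => by
      rw [hpos j hj]
      simp only [star_mul', star_add, hreal, hI, hstar]
      ring
  have hstarzero : ∀ m l, star (Y' m (0, l)) = -Complex.I * b := fun m l => by
    rw [hzero, star_mul', hreal, hI]
  simp only [Matrix.mul_apply, Matrix.conjTranspose_apply]
  refine ⟨fun k l => ?_, fun j hj k l => ?_, fun i hi k l => ?_, fun i j hi hj k l => ?_⟩
  · simp only [hstarzero]
    simp only [hzero, JqC, Matrix.of_apply, Finset.sum_const, Finset.card_univ,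
      Fintype.card_fin, nsmul_eq_mul]
    push_cast
    linear_combination -(q : ℂ) * b ^ 2 * Complex.I_sq
  · simp only [hstarzero, hpos j hj, JqC, Matrix.of_apply]
    rw [← Finset.mul_sum, ← Finset.mul_sum, hcolsum]
    ring
  · simp only [hstarpos i hi, hzero, JqC, Matrix.of_apply]
    rw [← Finset.sum_mul, ← Finset.mul_sum, hcolsum']
    ring
  · have hdiag : ∑ m, (1 : Matrix (Fin q) (Fin q) ℂ) m k * (1 : Matrix (Fin q) (Fin q) ℂ) m l
        = (1 : Matrix (Fin q) (Fin q) ℂ) k l := by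
      simp [Matrix.one_apply, eq_comm]
    have hleft : ∑ m, (1 : Matrix (Fin q) (Fin q) ℂ) m k * (Q m l : ℂ) = Q k l := by
      simp [Matrix.one_apply]
    have hright : ∑ m, (Q m k : ℂ) * (1 : Matrix (Fin q) (Fin q) ℂ) m l = Q k l := by
      simp [Matrix.one_apply, hsymm k l]
    have hexpand : ∀ m, star (Y' m (i, k)) * Y' m (j, l) = (S 0 i : ℂ) * (S 0 j : ℂ) *
        (a ^ 2 * ((1 : Matrix (Fin q) (Fin q) ℂ) m k * (1 : Matrix (Fin q) (Fin q) ℂ) m l)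
          + Complex.I * a * b * ((1 : Matrix (Fin q) (Fin q) ℂ) m k * (Q m l : ℂ))
          - Complex.I * a * b * ((Q m k : ℂ) * (1 : Matrix (Fin q) (Fin q) ℂ) m l)
          + b ^ 2 * ((Q m k : ℂ) * (Q m l : ℂ))) := fun m => by
      rw [hstarpos i hi, hpos j hj]
      linear_combination
        -(S 0 i : ℂ) * (S 0 j : ℂ) * b ^ 2 * (Q m k : ℂ) * (Q m l : ℂ) * Complex.I_sq
    simp only [hexpand]
    rw [← Finset.mul_sum, Finset.sum_add_distrib, Finset.sum_sub_distrib, Finset.sum_add_distrib,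
      ← Finset.mul_sum, ← Finset.mul_sum, ← Finset.mul_sum, ← Finset.mul_sum,
      hdiag, hleft, hright, hgram]
    simp only [Matrix.add_apply, Matrix.sub_apply, Matrix.smul_apply, smul_eq_mul, JqC,
      Matrix.of_apply, Complex.ofReal_natCast]
    ring
end

section
/- Let n ≥ 1 and let X be an n×n quaternion matrix with X * Xᴴ = (n : ℝ) • 1 (a full quaternionic orthogonal design evaluated at unit-modulus values of its variables). Let m ≤ n and let X₁ be the m×n submatrix of X consisting of its first m rows. Then X₁ * X₁ᴴ = (n : ℝ) • 1_m, and the matrix P := (n : ℝ)⁻¹ • (X₁ᴴ * X₁) satisfies P * P = P. (By Waldron's criterion for tight frames over ℍ, the n columns of X₁ therefore form a tight frame for ℍ^m with frame constant n; if moreover all off-diagonal entries of X₁ᴴ * X₁ have the same quaternion norm, this frame is an equiangular tight frame.) -/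
open Quaternion Matrix

/-- If the rows of `V` are orthogonal with common squared norm `c`, then `c⁻¹ • (Vᴴ * V)` is
idempotent. -/
theorem inv_smul_conjTranspose_mul_self_mul_self {m n : Type*} [Fintype m] [Fintype n]
    [DecidableEq m] {V : Matrix m n ℍ[ℝ]} {c : ℝ} (hc : c ≠ 0) (hV : V * Vᴴ = c • 1) :
    (c⁻¹ • (Vᴴ * V)) * (c⁻¹ • (Vᴴ * V)) = c⁻¹ • (Vᴴ * V) := by
  have hsq : (Vᴴ * V) * (Vᴴ * V) = c • (Vᴴ * V) := by
    rw [Matrix.mul_assoc, ← Matrix.mul_assoc V, hV, Matrix.smul_mul, Matrix.one_mul,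
      Matrix.mul_smul]
  rw [Matrix.smul_mul, Matrix.mul_smul, hsq, inv_smul_smul₀ hc]

/-- For a full quaternionic orthogonal design `X` of order `n` (evaluated at unit-modulus
values, so `X * Xᴴ = n • 1`), the submatrix `X₁` of the first `m` rows satisfies
`X₁ * X₁ᴴ = n • 1` and `P = n⁻¹ • (X₁ᴴ * X₁)` is idempotent: by Waldron's criterion the
columns of `X₁` form a tight frame for `ℍ^m` with frame constant `n`. -/
theorem submatrix_tight_frame (n m : ℕ) (hn : 1 ≤ n) (hm : m ≤ n)
    (X : Matrix (Fin n) (Fin n) ℍ[ℝ])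
    (hX : X * Xᴴ = (n : ℝ) • 1) :
    let X₁ : Matrix (Fin m) (Fin n) ℍ[ℝ] := Matrix.of fun i j => X (Fin.castLE hm i) j
    X₁ * X₁ᴴ = (n : ℝ) • 1 ∧
      ((n : ℝ)⁻¹ • (X₁ᴴ * X₁)) * ((n : ℝ)⁻¹ • (X₁ᴴ * X₁)) = (n : ℝ)⁻¹ • (X₁ᴴ * X₁) := by
  intro X₁
  have hX₁ : X₁ * X₁ᴴ = (n : ℝ) • 1 := by
    have hsub : X₁ = X.submatrix (Fin.castLE hm) id := rfl
    rw [hsub, conjTranspose_submatrix, ← submatrix_mul X Xᴴ _ _ _ Function.bijective_id, hX,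
      submatrix_smul, Pi.smul_apply, Pi.smul_apply,
      submatrix_one _ (Fin.castLE_injective hm)]
  exact ⟨hX₁, inv_smul_conjTranspose_mul_self_mul_self
    (Nat.cast_ne_zero.mpr (Nat.one_le_iff_ne_zero.mp hn)) hX₁⟩
end
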